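/- The complete multigraph K_7^{(22)} on 7 vertices with edge multiplicity 22 has a decomposition into 7 copies of the family of all trees of order 7: there exists a multiset M of spanning trees of the complete graph on 7 vertices such that every isomorphism class of trees on 7 vertices is represented by exactly 7 members of M (counted with multiplicity), and every pair of distinct vertices is an edge of exactly 22 members of M (counted with multiplicity). -/

import Mathlib

/-- Cyclic distance `dc_n(s,t)`. -/
def dc (n s t : ℕ) : ℕ := min (Nat.dist s t) (n - Nat.dist s t)

/-- `dc` as a function on unordered pairs. -/
def dcSym2 (n : ℕ) : Sym2 ℕ → ℕ :=
  Sym2.lift ⟨dc n, fun s t => by simp [dc, Nat.dist_comm]⟩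

/-- Multiset of induced edge labels `dc_n(lab u, lab v)` over the edges of `T`. -/
noncomputable def edgeLabels {V : Type*} [Finite V] (n : ℕ) (T : SimpleGraph V)
    (lab : V → ℕ) : Multiset ℕ :=
  (T.edgeSet.toFinite.toFinset).val.map (fun e => dcSym2 n (Sym2.map lab e))

/-- A graph on `2n+1` vertices is semigraceful if some bijective labeling by `1,…,2n+1`
induces the multiset `{1,1,2,2,…,n,n}` of cyclic-distance edge labels. -/
def IsSemigraceful {V : Type*} [Finite V] (n : ℕ) (T : SimpleGraph V) : Prop :=
  ∃ ℓ : V ≃ Fin (2 * n + 1),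
    edgeLabels (2 * n + 1) T (fun v => (ℓ v : ℕ) + 1) =
      Multiset.Icc 1 n + Multiset.Icc 1 n

/-- A graph on `p` vertices is graceful if some bijective labeling by `0,…,p-1` makes the
induced absolute-difference edge labels pairwise distinct. -/
def IsGraceful {V : Type*} [Finite V] (p : ℕ) (T : SimpleGraph V) : Prop :=
  ∃ ℓ : V ≃ Fin p,
    Set.InjOn
      (Sym2.lift ⟨fun u v => Nat.dist (ℓ u : ℕ) (ℓ v : ℕ), fun u v => Nat.dist_comm _ _⟩)
      T.edgeSet

/-- Number of members of a multiset satisfying a (not necessarily decidable) predicate. -/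
noncomputable def countP' {α : Type*} (p : α → Prop) (M : Multiset α) : ℕ :=
  @Multiset.countP α p (Classical.decPred p) M

/-- The number of isomorphism classes of trees on `m` vertices. -/
noncomputable def tau (m : ℕ) : ℕ :=
  Nat.card (Quot fun G H : { T : SimpleGraph (Fin m) // T.IsTree } => Nonempty (G.1 ≃g H.1))

/-- The graph joining every `i` to its parent `p i`. -/
def parentGraph {n : ℕ} (p : Fin n → Fin n) : SimpleGraph (Fin n) where
  Adj i j := i ≠ j ∧ (p i = j ∨ p j = i)
  symm := ⟨fun _ _ h => ⟨h.1.symm, h.2.symm⟩⟩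
  loopless := ⟨fun _ h => h.1 rfl⟩

instance {n : ℕ} (p : Fin n → Fin n) : DecidableRel (parentGraph p).Adj :=
  fun i j => inferInstanceAs (Decidable (i ≠ j ∧ (p i = j ∨ p j = i)))

lemma parentGraph_isTree {n : ℕ} {p : Fin (n + 1) → Fin (n + 1)} (h₀ : p 0 = 0)
    (hp : ∀ i, p^[n] i = 0) : (parentGraph p).IsTree := by
  have reach : ∀ k i, (parentGraph p).Reachable i (p^[k] i) := by
    intro k
    induction k with
    | zero => exact fun i => SimpleGraph.Reachable.rfl
    | succ k ih =>
      intro i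
      rw [Function.iterate_succ_apply]
      refine SimpleGraph.Reachable.trans ?_ (ih (p i))
      by_cases h : i = p i
      · rw [← h]
      · exact SimpleGraph.Adj.reachable ⟨h, Or.inl rfl⟩
  have reach₀ (i) : (parentGraph p).Reachable i 0 := by simpa [hp i] using reach n i
  have conn : (parentGraph p).Connected :=
    (SimpleGraph.connected_iff _).2 ⟨fun i j => (reach₀ i).trans (reach₀ j).symm, ⟨0⟩⟩
  refine SimpleGraph.isTree_iff_connected_and_card.2
    ⟨conn, le_antisymm ?_ conn.card_vert_le_card_edgeSet_add_one⟩
  have sub : (parentGraph p).edgeSet ⊆ Set.range fun i : Fin n => s(i.succ, p i.succ) := by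
    intro e
    induction e with
    | h a b =>
      rintro ⟨hab, h | h⟩
      · obtain ⟨i, rfl⟩ := Fin.exists_succ_eq.2 (show a ≠ 0 by rintro rfl; exact hab (h₀ ▸ h))
        exact ⟨i, by simp [h]⟩
      · obtain ⟨i, rfl⟩ := Fin.exists_succ_eq.2 (show b ≠ 0 by rintro rfl; exact hab (h ▸ h₀))
        exact ⟨i, by simp [h, Sym2.eq_swap]⟩
  have card : (parentGraph p).edgeSet.ncard ≤ n := by
    refine (Set.ncard_le_ncard sub (Set.finite_range _)).trans ?_
    rw [← Set.image_univ]
    exact (Set.ncard_image_le Set.finite_univ).trans (by simp)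
  rw [Nat.card_coe_set_eq, Nat.card_fin]
  exact Nat.succ_le_succ card

/-- Attach a new last vertex to the vertex `a`. -/
def attach {n : ℕ} (p : Fin n → Fin n) (a : Fin n) : Fin (n + 1) → Fin (n + 1) :=
  Fin.snoc (fun i => (p i).castSucc) a.castSucc

lemma attach_castSucc {n : ℕ} (p : Fin n → Fin n) (a i : Fin n) :
    attach p a i.castSucc = (p i).castSucc :=
  Fin.snoc_castSucc (α := fun _ => Fin (n + 1)) _ _ _

lemma attach_last {n : ℕ} (p : Fin n → Fin n) (a : Fin n) :
    attach p a (Fin.last n) = a.castSucc :=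
  Fin.snoc_last (α := fun _ => Fin (n + 1)) _ _

lemma parentGraph_attach_adj_last {n : ℕ} (p : Fin n → Fin n) (a j : Fin n) :
    (parentGraph (attach p a)).Adj (Fin.last n) j.castSucc ↔ a = j := by
  simp [parentGraph, attach_castSucc, attach_last, Fin.castSucc_ne_last,
    (Fin.castSucc_ne_last _).symm]

lemma parentGraph_attach_adj_castSucc {n : ℕ} (p : Fin n → Fin n) (a i j : Fin n) :
    (parentGraph (attach p a)).Adj i.castSucc j.castSucc ↔ (parentGraph p).Adj i j := by
  simp [parentGraph, attach_castSucc]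

/-- Every tree on `n` vertices is isomorphic to one of the graphs described by `F`. -/
def RepresentsTrees {n m : ℕ} (F : Fin m → Fin n → Fin n) : Prop :=
  ∀ T : SimpleGraph (Fin n), T.IsTree → ∃ k, Nonempty (T ≃g parentGraph (F k))

lemma exists_iso_attach {n m : ℕ} {F : Fin m → Fin (n + 1) → Fin (n + 1)}
    (hF : RepresentsTrees F) (T : SimpleGraph (Fin (n + 2))) (hT : T.IsTree) :
    ∃ k a, Nonempty (T ≃g parentGraph (attach (F k) a)) := by
  classical
  obtain ⟨v, hv⟩ := hT.exists_vert_degree_one_of_nontrivial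
  let g : T.comap v.succAbove ≃g T.induce {v}ᶜ :=
    { toEquiv := finSuccAboveEquiv v
      map_rel_iff' := Iff.rfl }
  have hdel : (T.comap v.succAbove).IsTree :=
    g.isTree_iff.2 ⟨hT.connected.induce_compl_singleton_of_degree_eq_one hv,
      hT.isAcyclic.induce _⟩
  obtain ⟨k, ⟨e⟩⟩ := hF _ hdel
  obtain ⟨u, hvu, hu⟩ := SimpleGraph.degree_eq_one_iff_existsUnique_adj.1 hv
  obtain ⟨w, rfl⟩ := Fin.exists_succAbove_eq hvu.ne'
  have hvw (j) : T.Adj v (v.succAbove j) ↔ e w = e j := by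
    rw [e.injective.eq_iff]
    exact ⟨fun h => (Fin.succAbove_right_injective (hu _ h)).symm, by rintro rfl; exact hvu⟩
  let f : Fin (n + 2) ≃ Fin (n + 2) :=
    (finSuccEquiv' v).trans ((Equiv.optionCongr e.toEquiv).trans (finSuccEquiv' (Fin.last _)).symm)
  have f_v : f v = Fin.last _ := by simp [f]
  have f_succ (j) : f (v.succAbove j) = (e j).castSucc := by simp [f]
  refine ⟨k, e w, ⟨⟨f, ?_⟩⟩⟩
  intro a b
  change (parentGraph _).Adj (f a) (f b) ↔ T.Adj a b
  rcases Fin.eq_self_or_eq_succAbove v a with ha | ⟨i, ha⟩ <;>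
    rcases Fin.eq_self_or_eq_succAbove v b with hb | ⟨j, hb⟩ <;> rw [ha, hb]
  · simp
  · rw [f_v, f_succ, hvw, parentGraph_attach_adj_last]
  · rw [SimpleGraph.adj_comm, T.adj_comm, f_v, f_succ, hvw, parentGraph_attach_adj_last]
  · rw [f_succ, f_succ, parentGraph_attach_adj_castSucc]
    exact e.map_adj_iff

/-- A bijection that is compatible with the parent functions `p` and `q`. -/
def IsParentIso {n : ℕ} (p q s : Fin n → Fin n) : Prop :=
  Function.Injective s ∧
    ∀ i j, (parentGraph q).Adj (s i) (s j) ↔ (parentGraph p).Adj i j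

instance {n : ℕ} (p q s : Fin n → Fin n) : Decidable (IsParentIso p q s) :=
  inferInstanceAs (Decidable (_ ∧ _))

lemma IsParentIso.nonempty_iso {n : ℕ} {p q s : Fin n → Fin n} (h : IsParentIso p q s) :
    Nonempty (parentGraph p ≃g parentGraph q) :=
  ⟨⟨Equiv.ofBijective s (Finite.injective_iff_bijective.1 h.1), h.2 _ _⟩⟩

lemma RepresentsTrees.succ {n m m' : ℕ} {F : Fin m → Fin (n + 1) → Fin (n + 1)}
    {F' : Fin m' → Fin (n + 2) → Fin (n + 2)}
    (c : Fin m → Fin (n + 1) → Fin m' × (Fin (n + 2) → Fin (n + 2)))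
    (hF : RepresentsTrees F)
    (hc : ∀ k a, IsParentIso (attach (F k) a) (F' (c k a).1) (c k a).2) :
    RepresentsTrees F' := by
  intro T hT
  obtain ⟨k, a, ⟨e⟩⟩ := exists_iso_attach hF T hT
  obtain ⟨e'⟩ := (hc k a).nonempty_iso
  exact ⟨_, ⟨e.trans e'⟩⟩

/-- Parent functions of the trees of order one. -/
def treesOfOrderOne : Fin 1 → Fin 1 → Fin 1 :=
  ![![0]]

/-- Parent functions of the trees of order two. -/
def treesOfOrderTwo : Fin 1 → Fin 2 → Fin 2 :=
  ![![0, 0]]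

/-- Parent functions of the trees of order three. -/
def treesOfOrderThree : Fin 1 → Fin 3 → Fin 3 :=
  ![![0, 0, 0]]

/-- Parent functions of the trees of order four. -/
def treesOfOrderFour : Fin 2 → Fin 4 → Fin 4 :=
  ![![0, 0, 0, 0],
    ![0, 0, 0, 1]]

/-- Parent functions of the trees of order five. -/
def treesOfOrderFive : Fin 3 → Fin 5 → Fin 5 :=
  ![![0, 0, 0, 0, 0],
    ![0, 0, 0, 0, 1],
    ![0, 0, 0, 1, 2]]

/-- Parent functions of the trees of order six. -/
def treesOfOrderSix : Fin 6 → Fin 6 → Fin 6 :=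
  ![![0, 0, 0, 0, 0, 0],
    ![0, 0, 0, 0, 0, 1],
    ![0, 0, 0, 0, 1, 1],
    ![0, 0, 0, 0, 1, 2],
    ![0, 0, 0, 0, 1, 4],
    ![0, 0, 0, 1, 2, 3]]

/-- Parent functions of the trees of order seven. -/
def treesOfOrderSeven : Fin 11 → Fin 7 → Fin 7 :=
  ![![0, 0, 0, 0, 0, 0, 0],
    ![0, 0, 0, 0, 0, 0, 5],
    ![0, 0, 0, 0, 0, 4, 4],
    ![0, 0, 0, 0, 0, 4, 1],
    ![0, 0, 0, 0, 0, 3, 5],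
    ![0, 0, 0, 0, 1, 4, 1],
    ![0, 0, 0, 0, 3, 2, 1],
    ![0, 0, 0, 0, 1, 3, 5],
    ![0, 0, 0, 0, 1, 4, 4],
    ![0, 0, 0, 1, 1, 2, 5],
    ![0, 0, 6, 5, 3, 2, 1]]

/-- Attaching a vertex to a tree of order one yields a listed tree, by the given bijection. -/
def attachIsoOne : Fin 1 → Fin 1 → Fin 1 × (Fin 2 → Fin 2) :=
  ![![(0, ![0, 1])]]

/-- Attaching a vertex to a tree of order two yields a listed tree, by the given bijection. -/
def attachIsoTwo : Fin 1 → Fin 2 → Fin 1 × (Fin 3 → Fin 3) :=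
  ![![(0, ![0, 1, 2]),
     (0, ![1, 0, 2])]]

/-- Attaching a vertex to a tree of order three yields a listed tree, by the given bijection. -/
def attachIsoThree : Fin 1 → Fin 3 → Fin 2 × (Fin 4 → Fin 4) :=
  ![![(0, ![0, 1, 2, 3]),
     (1, ![0, 1, 2, 3]),
     (1, ![0, 2, 1, 3])]]

/-- Attaching a vertex to a tree of order four yields a listed tree, by the given bijection. -/
def attachIsoFour : Fin 2 → Fin 4 → Fin 3 × (Fin 5 → Fin 5) :=
  ![![(0, ![0, 1, 2, 3, 4]),
     (1, ![0, 1, 2, 3, 4]),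
     (1, ![0, 2, 1, 3, 4]),
     (1, ![0, 2, 3, 1, 4])],
    ![(1, ![0, 1, 2, 4, 3]),
     (1, ![1, 0, 4, 2, 3]),
     (2, ![0, 1, 2, 3, 4]),
     (2, ![1, 0, 3, 2, 4])]]

/-- Attaching a vertex to a tree of order five yields a listed tree, by the given bijection. -/
def attachIsoFive : Fin 3 → Fin 5 → Fin 6 × (Fin 6 → Fin 6) :=
  ![![(0, ![0, 1, 2, 3, 4, 5]),
     (1, ![0, 1, 2, 3, 4, 5]),
     (1, ![0, 2, 1, 3, 4, 5]),
     (1, ![0, 2, 3, 1, 4, 5]),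
     (1, ![0, 2, 3, 4, 1, 5])],
    ![(1, ![0, 1, 2, 3, 5, 4]),
     (2, ![0, 1, 2, 3, 4, 5]),
     (3, ![0, 1, 2, 3, 4, 5]),
     (3, ![0, 1, 3, 2, 4, 5]),
     (4, ![0, 1, 2, 3, 4, 5])],
    ![(3, ![0, 1, 2, 4, 5, 3]),
     (4, ![1, 0, 4, 2, 5, 3]),
     (4, ![1, 4, 0, 5, 2, 3]),
     (5, ![0, 1, 2, 3, 4, 5]),
     (5, ![0, 2, 1, 4, 3, 5])]]

/-- Attaching a vertex to a tree of order six yields a listed tree, by the given bijection. -/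
def attachIsoSix : Fin 6 → Fin 6 → Fin 11 × (Fin 7 → Fin 7) :=
  ![![(0, ![0, 1, 2, 3, 4, 5, 6]),
     (1, ![0, 5, 1, 2, 3, 4, 6]),
     (1, ![0, 1, 5, 2, 3, 4, 6]),
     (1, ![0, 1, 2, 5, 3, 4, 6]),
     (1, ![0, 1, 2, 3, 5, 4, 6]),
     (1, ![0, 1, 2, 3, 4, 5, 6])],
    ![(1, ![0, 5, 1, 2, 3, 6, 4]),
     (2, ![0, 4, 1, 2, 3, 5, 6]),
     (3, ![0, 1, 4, 2, 3, 6, 5]),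
     (3, ![0, 1, 2, 4, 3, 6, 5]),
     (3, ![0, 1, 2, 3, 4, 6, 5]),
     (4, ![0, 3, 1, 2, 4, 5, 6])],
    ![(2, ![0, 4, 1, 2, 5, 6, 3]),
     (2, ![4, 0, 5, 6, 1, 2, 3]),
     (5, ![1, 0, 4, 6, 2, 3, 5]),
     (5, ![1, 0, 6, 4, 2, 3, 5]),
     (5, ![0, 1, 2, 3, 4, 6, 5]),
     (5, ![0, 1, 2, 3, 6, 4, 5])],
    ![(3, ![0, 1, 4, 2, 6, 5, 3]),
     (5, ![1, 0, 4, 6, 2, 5, 3]),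
     (5, ![1, 4, 0, 6, 5, 2, 3]),
     (6, ![0, 1, 2, 3, 6, 5, 4]),
     (7, ![0, 3, 1, 2, 5, 4, 6]),
     (7, ![0, 1, 3, 2, 4, 5, 6])],
    ![(4, ![0, 3, 1, 2, 5, 6, 4]),
     (5, ![0, 1, 2, 3, 4, 5, 6]),
     (7, ![0, 3, 1, 2, 5, 6, 4]),
     (7, ![0, 3, 2, 1, 5, 6, 4]),
     (8, ![0, 1, 2, 3, 4, 5, 6]),
     (9, ![1, 0, 3, 4, 2, 5, 6])],
    ![(7, ![0, 3, 1, 5, 4, 6, 2]),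
     (7, ![3, 0, 5, 1, 6, 4, 2]),
     (9, ![0, 2, 1, 5, 3, 6, 4]),
     (9, ![2, 0, 5, 1, 6, 3, 4]),
     (10, ![2, 5, 6, 3, 1, 4, 0]),
     (10, ![5, 2, 3, 6, 4, 1, 0])]]

lemma representsTrees_one : RepresentsTrees treesOfOrderOne := fun T _ =>
  ⟨0, ⟨⟨Equiv.refl _, fun {a b} => by simp [Subsingleton.elim b a]⟩⟩⟩

lemma representsTrees_seven : RepresentsTrees treesOfOrderSeven :=
  representsTrees_one
    |>.succ (F' := treesOfOrderTwo) attachIsoOne (by decide +kernel)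
    |>.succ (F' := treesOfOrderThree) attachIsoTwo (by decide +kernel)
    |>.succ (F' := treesOfOrderFour) attachIsoThree (by decide +kernel)
    |>.succ (F' := treesOfOrderFive) attachIsoFour (by decide +kernel)
    |>.succ (F' := treesOfOrderSix) attachIsoFive (by decide +kernel)
    |>.succ attachIsoSix (by decide +kernel)

/-- The number of walks of length four, as the sum over the middle vertex. -/
def fourWalks {V : Type*} [Fintype V] (G : SimpleGraph V) [DecidableRel G.Adj] : ℕ :=
  ∑ v, (∑ w, if G.Adj v w then ∑ x, if G.Adj w x then 1 else 0 else 0) ^ 2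

lemma fourWalks_eq_of_iso {V W : Type*} [Fintype V] [Fintype W] {G : SimpleGraph V}
    {H : SimpleGraph W} [DecidableRel G.Adj] [DecidableRel H.Adj] (e : G ≃g H) :
    fourWalks G = fourWalks H := by
  unfold fourWalks
  refine Fintype.sum_equiv e.toEquiv _ _ fun v => congrArg (· ^ 2) ?_
  refine Fintype.sum_equiv e.toEquiv _ _ fun w => ?_
  refine if_congr e.map_adj_iff.symm ?_ rfl
  exact Fintype.sum_equiv e.toEquiv _ _ fun x => if_congr e.map_adj_iff.symm rfl rfl

lemma treesOfOrderSeven_fourWalks_injective :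
    Function.Injective fun k => fourWalks (parentGraph (treesOfOrderSeven k)) := by
  decide +kernel

/-- The tree `treesOfOrderSeven x.1`, rotated cyclically by `x.2`. -/
def rotatedTree (x : Fin 11 × Fin 7) : SimpleGraph (Fin 7) :=
  (parentGraph (treesOfOrderSeven x.1)).comap (Equiv.addRight x.2)

instance (x : Fin 11 × Fin 7) : DecidableRel (rotatedTree x).Adj := fun a b =>
  inferInstanceAs (Decidable ((parentGraph (treesOfOrderSeven x.1)).Adj (a + x.2) (b + x.2)))

/-- `rotatedTree x` is isomorphic to the tree it is a rotation of. -/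
def rotatedTreeIso (x : Fin 11 × Fin 7) :
    rotatedTree x ≃g parentGraph (treesOfOrderSeven x.1) :=
  SimpleGraph.Iso.comap _ _

lemma rotatedTree_isTree (x : Fin 11 × Fin 7) : (rotatedTree x).IsTree :=
  (rotatedTreeIso x).isTree_iff.2 <| parentGraph_isTree
    ((by decide +kernel : ∀ k, treesOfOrderSeven k 0 = 0) x.1)
    ((by decide +kernel : ∀ k i, (treesOfOrderSeven k)^[6] i = 0) x.1)

lemma countP'_map_univ {α β : Type*} [Fintype α] (p : β → Prop) (f : α → β)
    [DecidablePred fun x => p (f x)] :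
    countP' p (Finset.univ.val.map f) = (Finset.univ.filter fun x => p (f x)).card := by
  classical
  rw [countP', Multiset.countP_map, Finset.card_def, Finset.filter_val]
  congr

/-- `K_7^{(22)}` decomposes into 7 copies of the family of all trees of
order 7. -/
theorem K7_22_decomposes_into_seven_copies_of_trees_of_order_seven :
    ∃ M : Multiset (SimpleGraph (Fin 7)),
      (∀ G ∈ M, G.IsTree) ∧
      (∀ T : SimpleGraph (Fin 7), T.IsTree →
        countP' (fun G => Nonempty (G ≃g T)) M = 7) ∧
      (∀ a b : Fin 7, a ≠ b → countP' (fun G => G.Adj a b) M = 22) := by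
  refine ⟨Finset.univ.val.map rotatedTree, ?_, fun T hT => ?_, fun a b hab => ?_⟩
  · simp only [Multiset.mem_map]
    rintro _ ⟨x, -, rfl⟩
    exact rotatedTree_isTree x
  · obtain ⟨k, ⟨e⟩⟩ := representsTrees_seven T hT
    have iso_iff (x) : Nonempty (rotatedTree x ≃g T) ↔ x.1 = k := by
      refine ⟨fun ⟨f⟩ => treesOfOrderSeven_fourWalks_injective
        (fourWalks_eq_of_iso ((rotatedTreeIso x).symm.trans (f.trans e))), ?_⟩
      rintro rfl
      exact ⟨(rotatedTreeIso x).trans e.symm⟩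
    classical
    rw [countP'_map_univ]
    simp only [iso_iff]
    exact (by decide +kernel :
      ∀ k, (Finset.univ.filter fun x : Fin 11 × Fin 7 => x.1 = k).card = 7) k
  · rw [countP'_map_univ]
    revert a b
    decide +kernel
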